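/- arXiv:1810.01504 — 3 statements merged into one kernel-verified Lean document; each statement's English description precedes it below -/
import Mathlib

section
/- The set of irreducible elements of the additive monoid M = {(r,s) ∈ ℕ × ℕ : 2s ≤ 5r ∧ 2r ≤ 3s} (i.e., the Hilbert basis of the monoid of lattice points in the cone between the rays through (2,5) and (3,2)) is exactly {(1,1), (1,2), (2,5), (3,2)}. Equivalently, every nonzero element of M is a sum of elements of {(1,1), (1,2), (2,5), (3,2)}, and none of these four elements can be written as a sum of two nonzero elements of M. -/
/-- The monoid of lattice points in the cone between the rays through (2,5) and (3,2):
    pairs (r,s) ∈ ℕ × ℕ with 2s ≤ 5r and 2r ≤ 3s. -/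
def M : Set (ℕ × ℕ) := {p | 2 * p.2 ≤ 5 * p.1 ∧ 2 * p.1 ≤ 3 * p.2}

/-- The claimed Hilbert basis. -/
def H : Set (ℕ × ℕ) := {(1, 1), (1, 2), (2, 5), (3, 2)}

/-- Every nonzero element of `M` has a generator from `H` as a summand in `M`. -/
lemma exists_eq_add_of_mem_M {v : ℕ × ℕ} (hv : v ∈ M) (h0 : v ≠ 0) :
    ∃ h ∈ H, ∃ w ∈ M, v = h + w := by
  obtain ⟨r, s⟩ := v
  simp only [M, Set.mem_ofPred_eq, ne_eq, Prod.mk_eq_zero] at hv h0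
  have key : ∀ a b : ℕ, (a, b) ∈ H → a ≤ r → b ≤ s → (r - a, s - b) ∈ M →
      ∃ h ∈ H, ∃ w ∈ M, (r, s) = h + w := fun a b hab ha hb hw =>
    ⟨(a, b), hab, (r - a, s - b), hw, by simp [ha, hb]⟩
  rcases lt_trichotomy s r with hsr | hsr | hsr
  · exact key 3 2 (by simp [H]) (by omega) (by omega)
      (by simp only [M, Set.mem_ofPred_eq]; omega)
  · exact key 1 1 (by simp [H]) (by omega) (by omega)
      (by simp only [M, Set.mem_ofPred_eq]; omega)
  · rcases le_or_gt s (2 * r) with hs | hs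
    · exact key 1 2 (by simp [H]) (by omega) (by omega)
        (by simp only [M, Set.mem_ofPred_eq]; omega)
    · exact key 2 5 (by simp [H]) (by omega) (by omega)
        (by simp only [M, Set.mem_ofPred_eq]; omega)

lemma H_subset_M : H ⊆ M := by
  rintro v (rfl | rfl | rfl | rfl) <;> simp [M]

lemma ne_zero_of_mem_H {v : ℕ × ℕ} (hv : v ∈ H) : v ≠ 0 := by
  rcases hv with rfl | rfl | rfl | rfl <;> simp

lemma ne_add_of_mem_H {v x y : ℕ × ℕ} (hv : v ∈ H) (hx : x ∈ M) (hy : y ∈ M)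
    (hx0 : x ≠ 0) (hy0 : y ≠ 0) : v ≠ x + y := by
  obtain ⟨a, b⟩ := x
  obtain ⟨c, d⟩ := y
  simp only [M, Set.mem_ofPred_eq, ne_eq, Prod.mk_eq_zero] at hx hy hx0 hy0
  rcases hv with rfl | rfl | rfl | rfl <;>
    simp only [Prod.mk_add_mk, ne_eq, Prod.mk.injEq] <;> omega

lemma mem_closure_H_of_mem_M {v : ℕ × ℕ} (hv : v ∈ M) : v ∈ AddSubmonoid.closure H := by
  induction hn : v.1 + v.2 using Nat.strong_induction_on generalizing v with
  | _ n ih =>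
    by_cases h0 : v = 0
    · exact h0 ▸ zero_mem _
    obtain ⟨h, hh, w, hw, rfl⟩ := exists_eq_add_of_mem_M hv h0
    have hpos : h.1 + h.2 ≠ 0 := fun hz =>
      ne_zero_of_mem_H hh (Prod.ext (Nat.eq_zero_of_add_eq_zero_right hz)
        (Nat.eq_zero_of_add_eq_zero_left hz))
    simp only [Prod.fst_add, Prod.snd_add] at hn
    exact add_mem (AddSubmonoid.subset_closure hh) (ih (w.1 + w.2) (by omega) hw rfl)

/-- The set of irreducible elements of M is exactly {(1,1), (1,2), (2,5), (3,2)};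
    equivalently, every element of M is a sum of elements of H, and no element of H
    decomposes as a sum of two nonzero elements of M. -/
theorem hilbert_basis_Q1 :
    {v ∈ M | v ≠ 0 ∧ ∀ x ∈ M, ∀ y ∈ M, x ≠ 0 → y ≠ 0 → v ≠ x + y} = H ∧
    ∀ v ∈ M, v ∈ AddSubmonoid.closure H := by
  refine ⟨Set.Subset.antisymm ?_ ?_, fun v => mem_closure_H_of_mem_M⟩
  · rintro v ⟨hv, h0, hirr⟩
    obtain ⟨h, hh, w, hw, rfl⟩ := exists_eq_add_of_mem_M hv h0
    by_cases hw0 : w = 0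
    · simpa [hw0] using hh
    · exact absurd rfl (hirr h (H_subset_M hh) w hw (ne_zero_of_mem_H hh) hw0)
  · exact fun v hv => ⟨H_subset_M hv, ne_zero_of_mem_H hv,
      fun x hx y hy => ne_add_of_mem_H hv hx hy⟩
end

section
/- Let S ⊆ ℝ⁴ be the set of points (x, y, z, w) satisfying all of the following: x ≥ 0, y ≥ 0, z ≥ 5x, z ≥ 2y, w ≥ 2x, w ≥ 3y; (z < 5x + 1 ∨ z < 2y + 1); (w < 2x + 1 ∨ w < 3y + 1); (x < 1 ∨ z < 2y + 5 ∨ w < 3y + 2); (y < 1 ∨ z < 5x + 2 ∨ w < 2x + 3); (x < 2 ∨ y < 5 ∨ w < 2x + 11); (x < 3 ∨ y < 2 ∨ z < 2y + 11); (x < 2 ∨ y < 1 ∨ z < 2y + 8 ∨ w < 3y + 1); (x < 1 ∨ y < 2 ∨ z < 2y + 1 ∨ w < 2x + 4); (x < 1 ∨ y < 1 ∨ z < 2y + 3 ∨ w < 2x + 1); and (x < 1 ∨ y < 3 ∨ z < 5x + 1 ∨ w < 2x + 7). Then the 4-dimensional Lebesgue measure (volume) of S equals 37283/9900. -/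
open MeasureTheory

/-- The Hilbert-Kunz polytope for B_R((x⁵y²),(x²y³)): points (x,y,z,w) ∈ ℝ⁴ satisfying the
    system of inequalities produced by the algorithm from the Hilbert set. -/
def S : Set (ℝ × ℝ × ℝ × ℝ) :=
  {p | 0 ≤ p.1 ∧ 0 ≤ p.2.1 ∧
       5 * p.1 ≤ p.2.2.1 ∧ 2 * p.2.1 ≤ p.2.2.1 ∧
       2 * p.1 ≤ p.2.2.2 ∧ 3 * p.2.1 ≤ p.2.2.2 ∧
       (p.2.2.1 < 5 * p.1 + 1 ∨ p.2.2.1 < 2 * p.2.1 + 1) ∧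
       (p.2.2.2 < 2 * p.1 + 1 ∨ p.2.2.2 < 3 * p.2.1 + 1) ∧
       (p.1 < 1 ∨ p.2.2.1 < 2 * p.2.1 + 5 ∨ p.2.2.2 < 3 * p.2.1 + 2) ∧
       (p.2.1 < 1 ∨ p.2.2.1 < 5 * p.1 + 2 ∨ p.2.2.2 < 2 * p.1 + 3) ∧
       (p.1 < 2 ∨ p.2.1 < 5 ∨ p.2.2.2 < 2 * p.1 + 11) ∧
       (p.1 < 3 ∨ p.2.1 < 2 ∨ p.2.2.1 < 2 * p.2.1 + 11) ∧
       (p.1 < 2 ∨ p.2.1 < 1 ∨ p.2.2.1 < 2 * p.2.1 + 8 ∨ p.2.2.2 < 3 * p.2.1 + 1) ∧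
       (p.1 < 1 ∨ p.2.1 < 2 ∨ p.2.2.1 < 2 * p.2.1 + 1 ∨ p.2.2.2 < 2 * p.1 + 4) ∧
       (p.1 < 1 ∨ p.2.1 < 1 ∨ p.2.2.1 < 2 * p.2.1 + 3 ∨ p.2.2.2 < 2 * p.1 + 1) ∧
       (p.1 < 1 ∨ p.2.1 < 3 ∨ p.2.2.1 < 5 * p.1 + 1 ∨ p.2.2.2 < 2 * p.1 + 7)}

/-- The area under the graph of a nonnegative continuous function over the unit interval, with the
argument of the function as second coordinate. -/
lemma volume_subgraph_unit (φ : ℝ → ℝ) (hφ : Continuous φ) (h0 : ∀ v ∈ Set.Ico (0 : ℝ) 1, 0 ≤ φ v) :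
    volume {s : ℝ × ℝ | 0 ≤ s.2 ∧ s.2 < 1 ∧ 0 ≤ s.1 ∧ s.1 < φ s.2} =
      ENNReal.ofReal (∫ v in (0 : ℝ)..1, φ v) := by
  have hm : MeasurableSet {s : ℝ × ℝ | 0 ≤ s.2 ∧ s.2 < 1 ∧ 0 ≤ s.1 ∧ s.1 < φ s.2} := by
    have := hφ.measurable
    measurability
  rw [Measure.volume_eq_prod, Measure.prod_apply_symm hm,
    intervalIntegral.integral_of_le zero_le_one, ← integral_Ico_eq_integral_Ioc,
    ofReal_integral_eq_lintegral_ofReal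
      ((hφ.integrableOn_Icc (a := 0) (b := 1)).mono_set Set.Ico_subset_Icc_self)
      ((ae_restrict_mem measurableSet_Ico).mono h0),
    ← lintegral_indicator measurableSet_Ico]
  refine lintegral_congr fun v => ?_
  by_cases hv : v ∈ Set.Ico (0 : ℝ) 1
  · rw [Set.indicator_of_mem hv, ← sub_zero (φ v), ← Real.volume_Ico]
    congr 1
    ext q
    simp [hv.1, hv.2]
  · rw [Set.indicator_of_notMem hv]
    have : (fun q : ℝ => (q, v)) ⁻¹' {s : ℝ × ℝ | 0 ≤ s.2 ∧ s.2 < 1 ∧ 0 ≤ s.1 ∧ s.1 < φ s.2} = ∅ := by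
      ext q
      simp only [Set.mem_preimage, Set.mem_ofPred_eq, Set.mem_empty_iff_false, iff_false]
      exact fun h => hv ⟨h.1, h.2.1⟩
    rw [this, measure_empty]

lemma volume_subgraph_max {A B m c : ℝ} (hA : 0 ≤ A) (hm : 0 ≤ m) (hc0 : 0 ≤ c) (hc1 : c ≤ 1)
    (hc : B - m * c = A) :
    volume {s : ℝ × ℝ | 0 ≤ s.2 ∧ s.2 < 1 ∧ 0 ≤ s.1 ∧ (s.1 < A ∨ s.1 < B - m * s.2)} =
      ENNReal.ofReal (A + m * c ^ 2 / 2) := by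
  have hcont : Continuous fun v : ℝ => max A (B - m * v) := by fun_prop
  have h := volume_subgraph_unit (fun v => max A (B - m * v)) hcont fun v _ => le_max_of_le_left hA
  simp only [lt_max_iff] at h
  rw [h, ← intervalIntegral.integral_add_adjacent_intervals (b := c)
    (hcont.intervalIntegrable _ _) (hcont.intervalIntegrable _ _)]
  have h1 : ∫ v in (0 : ℝ)..c, max A (B - m * v) = ∫ v in (0 : ℝ)..c, (B - m * v) := by
    refine intervalIntegral.integral_congr fun v hv => ?_
    rw [Set.uIcc_of_le hc0] at hv
    exact max_eq_right (by nlinarith [mul_le_mul_of_nonneg_left hv.2 hm])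
  have h2 : ∫ v in c..(1 : ℝ), max A (B - m * v) = ∫ v in c..(1 : ℝ), A := by
    refine intervalIntegral.integral_congr fun v hv => ?_
    rw [Set.uIcc_of_le hc1] at hv
    exact max_eq_left (by nlinarith [mul_le_mul_of_nonneg_left hv.1 hm])
  rw [h1, h2, intervalIntegral.integral_sub (by simp)
    (Continuous.intervalIntegrable (by fun_prop) _ _),
    intervalIntegral.integral_const_mul]
  simp only [intervalIntegral.integral_const, integral_id, smul_eq_mul]
  congr 1
  linear_combination c * hc

lemma volume_box {A : ℝ} (hA : 0 ≤ A) :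
    volume {s : ℝ × ℝ | 0 ≤ s.2 ∧ s.2 < 1 ∧ 0 ≤ s.1 ∧ s.1 < A} = ENNReal.ofReal A := by
  simpa using volume_subgraph_unit (fun _ => A) continuous_const fun _ _ => hA

lemma volume_truncated_triangle {m : ℝ} (h0 : 0 ≤ m) (h1 : m ≤ 1) :
    volume {s : ℝ × ℝ | 0 ≤ s.2 ∧ s.2 < 1 ∧ 0 ≤ s.1 ∧ s.1 + s.2 < 1 ∧ s.1 < m} =
      ENNReal.ofReal (m - m ^ 2 / 2) := by
  have hcont : Continuous fun v : ℝ => min (1 - v) m := by fun_prop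
  have h := volume_subgraph_unit (fun v => min (1 - v) m) hcont
    fun v hv => le_min (by linarith [hv.2]) h0
  simp only [lt_min_iff, lt_sub_iff_add_lt] at h
  rw [h, ← intervalIntegral.integral_add_adjacent_intervals (b := 1 - m)
    (hcont.intervalIntegrable _ _) (hcont.intervalIntegrable _ _)]
  have e1 : ∫ v in (0 : ℝ)..(1 - m), min (1 - v) m = ∫ v in (0 : ℝ)..(1 - m), m := by
    refine intervalIntegral.integral_congr fun v hv => ?_
    rw [Set.uIcc_of_le (by linarith)] at hv
    exact min_eq_right (by linarith [hv.2])
  have e2 : ∫ v in (1 - m)..(1 : ℝ), min (1 - v) m = ∫ v in (1 - m)..(1 : ℝ), (1 - v) := by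
    refine intervalIntegral.integral_congr fun v hv => ?_
    rw [Set.uIcc_of_le (by linarith)] at hv
    exact min_eq_left (by linarith [hv.1])
  rw [e1, e2, intervalIntegral.integral_sub (by simp) (Continuous.intervalIntegrable (by fun_prop) _ _)]
  simp only [intervalIntegral.integral_const, integral_id, smul_eq_mul]
  congr 1
  ring

/-- A set fibred over the unit interval, with one fibre over `[0, c)` and another over `[c, 1)`. -/
lemma volume_two_fibres {c a₁ a₂ : ℝ} {Q₁ Q₂ : Set (ℝ × ℝ)} (hc0 : 0 ≤ c) (hc1 : c ≤ 1)
    (ha₁ : 0 ≤ a₁) (ha₂ : 0 ≤ a₂) (hQ₂ : MeasurableSet Q₂) (h₁ : volume Q₁ = ENNReal.ofReal a₁)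
    (h₂ : volume Q₂ = ENNReal.ofReal a₂) :
    volume (Set.Ico 0 c ×ˢ Q₁ ∪ Set.Ico c 1 ×ˢ Q₂) = ENNReal.ofReal (c * a₁ + (1 - c) * a₂) := by
  have hd : AEDisjoint volume (Set.Ico 0 c ×ˢ Q₁) (Set.Ico c 1 ×ˢ Q₂) := by
    refine Disjoint.aedisjoint (Set.disjoint_left.2 ?_)
    rintro ⟨u, s⟩ ⟨h, -⟩ ⟨h', -⟩
    exact absurd h.2 (not_lt.2 h'.1)
  rw [measure_union₀ (measurableSet_Ico.prod hQ₂).nullMeasurableSet hd, Measure.volume_eq_prod, Measure.prod_prod, Measure.prod_prod, h₁, h₂,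
    Real.volume_Ico, Real.volume_Ico, ← ENNReal.ofReal_mul (by linarith),
    ← ENNReal.ofReal_mul (by linarith), sub_zero,
    ENNReal.ofReal_add (by positivity) (mul_nonneg (by linarith) ha₂)]

/-- Cavalieri's principle on a slab `a ≤ p < b`. -/
lemma volume_inter_lt_step {R : Set (ℝ × ℝ × ℝ × ℝ)} (hR : MeasurableSet R) {a b : ℝ} (hab : a ≤ b)
    {h : ℝ → ℝ} (hcont : Continuous h) (h0 : ∀ p ∈ Set.Ioo a b, 0 ≤ h p)
    (hs : ∀ p ∈ Set.Ioo a b, volume (Prod.mk p ⁻¹' R) = ENNReal.ofReal (h p)) :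
    volume (R ∩ {s | s.1 < b}) =
      volume (R ∩ {s | s.1 < a}) + ENNReal.ofReal (∫ p in a..b, h p) := by
  have key : volume (R ∩ {s | a ≤ s.1 ∧ s.1 < b}) = ENNReal.ofReal (∫ p in a..b, h p) := by
    have hm : MeasurableSet (R ∩ {s | a ≤ s.1 ∧ s.1 < b}) := by measurability
    rw [Measure.volume_eq_prod, Measure.prod_apply hm,
      intervalIntegral.integral_of_le hab, integral_Ioc_eq_integral_Ioo,
      ofReal_integral_eq_lintegral_ofReal
        ((hcont.integrableOn_Icc (a := a) (b := b)).mono_set Set.Ioo_subset_Icc_self)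
        ((ae_restrict_mem measurableSet_Ioo).mono h0),
      setLIntegral_congr Ioo_ae_eq_Ico, ← lintegral_indicator measurableSet_Ico]
    have hne : ∀ᵐ p : ℝ, p ≠ a := by simp [ae_iff]
    refine lintegral_congr_ae (hne.mono fun p hp => ?_)
    by_cases hpm : p ∈ Set.Ico a b
    · simp only [Set.indicator_of_mem hpm]
      rw [← hs p ⟨lt_of_le_of_ne hpm.1 hp.symm, hpm.2⟩]
      congr 1
      ext s
      simp [hpm.1, hpm.2]
    · simp only [Set.indicator_of_notMem hpm]
      have : Prod.mk p ⁻¹' (R ∩ {s : ℝ × ℝ × ℝ × ℝ | a ≤ s.1 ∧ s.1 < b}) = ∅ := by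
        ext s
        simp only [Set.mem_preimage, Set.mem_inter_iff, Set.mem_ofPred_eq, Set.mem_empty_iff_false,
          iff_false]
        exact fun h => hpm h.2
      rw [this, measure_empty]
  rw [← key, ← measure_union _ (by measurability)]
  · congr 1
    ext s
    simp only [Set.mem_union, Set.mem_inter_iff, Set.mem_ofPred_eq]
    constructor
    · rintro ⟨h1, h2⟩
      rcases lt_or_ge s.1 a with h3 | h3
      · exact Or.inl ⟨h1, h3⟩
      · exact Or.inr ⟨h1, h3, h2⟩
    · rintro (⟨h1, h2⟩ | ⟨h1, -, h2⟩)
      · exact ⟨h1, by linarith⟩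
      · exact ⟨h1, h2⟩
  · refine Set.disjoint_left.2 fun s h1 h2 => ?_
    exact absurd h1.2 (not_lt.2 h2.2.1)

/-- Linear equivalence between `Fin 4 → ℝ` and the iterated product. -/
def tupleEquiv : (Fin 4 → ℝ) ≃ₗ[ℝ] ℝ × ℝ × ℝ × ℝ where
  toFun f := (f 0, f 1, f 2, f 3)
  invFun p := ![p.1, p.2.1, p.2.2.1, p.2.2.2]
  map_add' _ _ := rfl
  map_smul' _ _ := rfl
  left_inv f := by ext i; fin_cases i <;> rfl
  right_inv _ := rfl

lemma volume_preimage_affine (M : Matrix (Fin 4) (Fin 4) ℝ) (hM : M.det ≠ 0)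
    (b : ℝ × ℝ × ℝ × ℝ) (R : Set (ℝ × ℝ × ℝ × ℝ)) :
    volume {p | tupleEquiv (M.mulVec (tupleEquiv.symm p)) + b ∈ R} =
      ENNReal.ofReal |M.det⁻¹| * volume R := by
  have h2 : (volume : Measure (ℝ × ℝ)).IsAddHaarMeasure :=
    Measure.prod.instIsAddHaarMeasure volume volume
  have h3 : (volume : Measure (ℝ × ℝ × ℝ)).IsAddHaarMeasure :=
    Measure.prod.instIsAddHaarMeasure volume volume
  have h4 : (volume : Measure (ℝ × ℝ × ℝ × ℝ)).IsAddHaarMeasure :=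
    Measure.prod.instIsAddHaarMeasure volume volume
  set L : (ℝ × ℝ × ℝ × ℝ) →ₗ[ℝ] ℝ × ℝ × ℝ × ℝ :=
    tupleEquiv.toLinearMap ∘ₗ Matrix.toLin' M ∘ₗ tupleEquiv.symm.toLinearMap with hL
  have hdet : L.det = M.det := by rw [hL, LinearMap.det_conj, LinearMap.det_toLin']
  have h := Measure.addHaar_preimage_linearMap volume (f := L) (hdet ▸ hM)
    ((fun x => x + b) ⁻¹' R)
  rw [measure_preimage_add_right, hdet] at h
  exact h

/-- The normal form of the two outer sectors of `S`, in coordinates `(t, u, x, v)`. -/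
def outerSector (α k : ℝ) : Set (ℝ × ℝ × ℝ × ℝ) :=
  {s | 0 ≤ s.2.1 ∧ s.2.1 < 1 ∧ 0 ≤ s.2.2.1 ∧ s.2.2.1 < 1 ∧ 0 ≤ s.2.2.2 ∧ s.2.2.2 < 1 ∧
    (s.2.2.1 < α * s.1 ∨ s.2.1 < 2 * s.1 ∨ s.2.2.2 < k * s.1 - 11 / 2 * s.2.2.1)}

lemma measurableSet_outerSector (α k : ℝ) : MeasurableSet (outerSector α k) := by
  unfold outerSector
  measurability

lemma volume_outerSector_half {α k β : ℝ} (hα : 0 ≤ α) (hα1 : α ≤ 2) (hk : k ≤ 11)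
    (hβ : 0 ≤ β) (hβ2 : β ≤ 2) (h : k - 11 / 2 * α = β) :
    volume (outerSector α k ∩ {s | s.1 < 1 / 2}) =
      ENNReal.ofReal (1 / 4 + α / 24 + β ^ 2 / 1056) := by
  have hm := measurableSet_outerSector α k
  have hzero : outerSector α k ∩ {s | s.1 < 0} = ∅ := by
    ext ⟨t, u, x, v⟩
    simp only [outerSector, Set.mem_inter_iff, Set.mem_ofPred_eq, Set.mem_empty_iff_false,
      iff_false]
    rintro ⟨⟨h1, h2, h3, h4, h5, h6, h7⟩, h8⟩
    have hk0 : 0 ≤ k := by linarith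
    rcases h7 with h7 | h7 | h7 <;> nlinarith
  rw [volume_inter_lt_step hm (a := 0) (by norm_num)
    (h := fun t => 2 * t * 1 + (1 - 2 * t) * (α * t + 2 / 11 * (β * t) ^ 2 / 2)) (by fun_prop)
    ?_ ?_, hzero, measure_empty, zero_add]
  · congr 1
    have hi : ∀ t : ℝ, 2 * t * 1 + (1 - 2 * t) * (α * t + 2 / 11 * (β * t) ^ 2 / 2) =
      (2 + α) * t ^ 1 + (β ^ 2 / 11 - 2 * α) * t ^ 2 - 2 * β ^ 2 / 11 * t ^ 3 := fun t => by ring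
    simp only [hi]
    rw [intervalIntegral.integral_sub (Continuous.intervalIntegrable (by fun_prop) _ _)
      (Continuous.intervalIntegrable (by fun_prop) _ _),
      intervalIntegral.integral_add (Continuous.intervalIntegrable (by fun_prop) _ _)
      (Continuous.intervalIntegrable (by fun_prop) _ _)]
    simp only [intervalIntegral.integral_const_mul, integral_pow]
    norm_num
    ring
  · rintro t ⟨h0, h1⟩
    have : 0 ≤ 1 - 2 * t := by linarith
    positivity
  · rintro t ⟨h0, h1⟩
    have hαt : α * t ≤ 1 := by nlinarith
    have hkt : k * t ≤ 11 / 2 := by nlinarith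
    rw [← volume_two_fibres (by linarith) (by linarith) zero_le_one (by positivity)
      (by measurability) (volume_box zero_le_one)
      (volume_subgraph_max (B := 2 / 11 * (k * t)) (by positivity) (by norm_num)
        (by positivity) (by nlinarith) (by rw [← h]; ring))]
    congr 1
    ext ⟨u, x, v⟩
    simp only [outerSector, Set.mem_preimage, Set.mem_union, Set.mem_prod, Set.mem_Ico,
      Set.mem_ofPred_eq]
    generalize α * t = a at *
    generalize k * t = b at *
    constructor
    · rintro ⟨h1, h2, h3, h4, h5, h6, h7⟩
      rcases lt_or_ge u (2 * t) with hu | hu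
      · exact Or.inl ⟨⟨h1, hu⟩, h5, h6, h3, h4⟩
      · refine Or.inr ⟨⟨hu, h2⟩, h5, h6, h3, ?_⟩
        rcases h7 with h7 | h7 | h7
        · exact Or.inl h7
        · linarith
        · exact Or.inr (by linarith)
    · rintro (⟨⟨h1, hu⟩, h5, h6, h3, h4⟩ | ⟨⟨hu, h2⟩, h5, h6, h3, h7⟩)
      · exact ⟨h1, by linarith, h3, h4, h5, h6, Or.inr (Or.inl hu)⟩
      · rcases h7 with h7 | h7
        · exact ⟨by linarith, h2, h3, by linarith, h5, h6, Or.inl h7⟩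
        · exact ⟨by linarith, h2, h3, by linarith, h5, h6, Or.inr (Or.inr (by linarith))⟩

lemma volume_outerSector_one (α k : ℝ) :
    volume (outerSector α k ∩ {s | s.1 < 1}) =
      volume (outerSector α k ∩ {s | s.1 < 1 / 2}) + ENNReal.ofReal (1 / 2) := by
  rw [volume_inter_lt_step (measurableSet_outerSector α k) (a := 1 / 2) (by norm_num)
    (h := fun _ => 1 * 1 + (1 - 1) * 1) (by fun_prop) (by norm_num) ?_]
  · norm_num
  · rintro t ⟨h0, h1⟩
    rw [← volume_two_fibres zero_le_one le_rfl zero_le_one zero_le_one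
      (by measurability) (volume_box zero_le_one) (volume_box zero_le_one)]
    congr 1
    ext ⟨u, x, v⟩
    simp only [outerSector, Set.mem_preimage, Set.mem_union, Set.mem_prod, Set.mem_Ico,
      Set.mem_ofPred_eq]
    constructor
    · rintro ⟨h1, h2, h3, h4, h5, h6, h7⟩
      exact Or.inl ⟨⟨h1, h2⟩, h5, h6, h3, h4⟩
    · rintro (⟨⟨h1, hu⟩, h5, h6, h3, h4⟩ | ⟨⟨hu, h2⟩, -⟩)
      · exact ⟨h1, by linarith, h3, h4, h5, h6, Or.inr (Or.inl (by linarith))⟩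
      · linarith

/-- The middle sector of `S`, in coordinates `p = 5x - 2y`, `u = z - 5x`, `q = 3y - 2x`,
`v = w - 3y`, listed as `(p, u, q, v)`. -/
def middleSector : Set (ℝ × ℝ × ℝ × ℝ) :=
  {s | 0 ≤ s.1 ∧ 0 ≤ s.2.1 ∧ s.2.1 < 1 ∧ 0 ≤ s.2.2.1 ∧ 0 ≤ s.2.2.2 ∧ s.2.2.2 < 1 ∧
    (3 * s.1 + 2 * s.2.2.1 < 22 ∨ 2 * s.1 + 5 * s.2.2.1 < 55 ∨ s.2.2.1 + s.2.2.2 < 11) ∧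
    (3 * s.1 + 2 * s.2.2.1 < 33 ∨ 2 * s.1 + 5 * s.2.2.1 < 22 ∨ s.1 + s.2.1 < 11) ∧
    (3 * s.1 + 2 * s.2.2.1 < 11 ∨ 2 * s.1 + 5 * s.2.2.1 < 22 ∨ s.1 + s.2.1 < 1 ∨
      s.2.2.1 + s.2.2.2 < 4) ∧
    (3 * s.1 + 2 * s.2.2.1 < 11 ∨ 2 * s.1 + 5 * s.2.2.1 < 11 ∨ s.1 + s.2.1 < 3 ∨
      s.2.2.1 + s.2.2.2 < 1)}

lemma measurableSet_middleSector : MeasurableSet middleSector := by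
  unfold middleSector
  measurability

lemma middleSector_fibre {p : ℝ} (T : Set (ℝ × ℝ × ℝ)) {a : ℝ} (hT : volume T = ENNReal.ofReal a)
    (h : ∀ u q v, (p, u, q, v) ∈ middleSector ↔ (u, q, v) ∈ T) :
    volume (Prod.mk p ⁻¹' middleSector) = ENNReal.ofReal a := by
  rw [← hT]
  congr 1
  ext ⟨u, q, v⟩
  exact h u q v

lemma integral_cubic (a b c d e f : ℝ) :
    ∫ p in a..b, (c + d * p ^ 1 + e * p ^ 2 + f * p ^ 3) =
      c * (b - a) + d * (b ^ 2 - a ^ 2) / 2 + e * (b ^ 3 - a ^ 3) / 3 + f * (b ^ 4 - a ^ 4) / 4 := by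
  rw [intervalIntegral.integral_add (Continuous.intervalIntegrable (by fun_prop) _ _)
      (Continuous.intervalIntegrable (by fun_prop) _ _),
    intervalIntegral.integral_add (Continuous.intervalIntegrable (by fun_prop) _ _)
      (Continuous.intervalIntegrable (by fun_prop) _ _),
    intervalIntegral.integral_add (Continuous.intervalIntegrable (by fun_prop) _ _)
      (Continuous.intervalIntegrable (by fun_prop) _ _)]
  simp only [intervalIntegral.integral_const_mul, integral_pow, intervalIntegral.integral_const,
    smul_eq_mul]
  norm_num
  ring

lemma middleSector_inter_step {a b : ℝ} (hab : a ≤ b) {h : ℝ → ℝ} {J : ℝ} (c d e f : ℝ)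
    (hc : ∀ p, h p = c + d * p ^ 1 + e * p ^ 2 + f * p ^ 3)
    (h0 : ∀ p ∈ Set.Ioo a b, 0 ≤ h p)
    (hs : ∀ p ∈ Set.Ioo a b, volume (Prod.mk p ⁻¹' middleSector) = ENNReal.ofReal (h p))
    (hJ : 0 ≤ J) (hJa : volume (middleSector ∩ {s | s.1 < a}) = ENNReal.ofReal J) :
    volume (middleSector ∩ {s | s.1 < b}) = ENNReal.ofReal
      (J + (c * (b - a) + d * (b ^ 2 - a ^ 2) / 2 + e * (b ^ 3 - a ^ 3) / 3 +
        f * (b ^ 4 - a ^ 4) / 4)) := by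
  have hi := integral_cubic a b c d e f
  simp only [← hc] at hi
  have hcont : Continuous h := by
    rw [funext hc]
    fun_prop
  rw [volume_inter_lt_step measurableSet_middleSector hab hcont h0 hs, hJa, ← hi,
    ← ENNReal.ofReal_add hJ]
  rw [intervalIntegral.integral_of_le hab, integral_Ioc_eq_integral_Ioo]
  exact setIntegral_nonneg measurableSet_Ioo h0

lemma middleSector_inter_zero : volume (middleSector ∩ {s | s.1 < 0}) = ENNReal.ofReal 0 := by
  have : middleSector ∩ {s | s.1 < 0} = ∅ := by
    ext s
    simp only [Set.mem_inter_iff, Set.mem_ofPred_eq, Set.mem_empty_iff_false, iff_false]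
    exact fun h => absurd h.1.1 (not_le.2 h.2)
  rw [this, measure_empty, ENNReal.ofReal_zero]

lemma middleSector_fibre_zero_one {p : ℝ} (h0 : 0 < p) (h1 : p < 1) :
    volume (Prod.mk p ⁻¹' middleSector) = ENNReal.ofReal
      ((1 - p) * (11 - 2 / 5 * p + 1 * (2 / 5 * p) ^ 2 / 2) +
        (1 - (1 - p)) * ((11 - 3 * p) / 2)) := by
  have hA : 0 ≤ 11 - 2 / 5 * p := by linarith
  refine middleSector_fibre _ (volume_two_fibres (by linarith) (by linarith) (by positivity)
    (by linarith) (by measurability)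
    (volume_subgraph_max (B := 11) hA zero_le_one (by linarith) (by linarith) (by ring))
    (volume_box (by linarith))) fun u q v => ?_
  simp only [middleSector, Set.mem_union, Set.mem_prod, Set.mem_Ico, Set.mem_ofPred_eq]
  grind

lemma middleSector_fibre_one_two {p : ℝ} (h0 : 1 < p) (h1 : p < 2) :
    volume (Prod.mk p ⁻¹' middleSector) = ENNReal.ofReal
      (1 * (4 - 2 / 5 * (p - 1) + 1 * (2 / 5 * (p - 1)) ^ 2 / 2) + (1 - 1) * 1) := by
  have hA : 0 ≤ 4 - 2 / 5 * (p - 1) := by linarith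
  refine middleSector_fibre _ (volume_two_fibres zero_le_one le_rfl (by positivity)
    zero_le_one (by measurability)
    (volume_subgraph_max (B := 4) hA zero_le_one (by linarith) (by linarith) (by ring))
    (volume_box zero_le_one)) fun u q v => ?_
  simp only [middleSector, Set.mem_union, Set.mem_prod, Set.mem_Ico, Set.mem_ofPred_eq]
  grind

lemma middleSector_fibre_two_three {p : ℝ} (h0 : 2 < p) (h1 : p < 3) :
    volume (Prod.mk p ⁻¹' middleSector) = ENNReal.ofReal
      ((3 - p) * (4 - 2 / 5 * (p - 1) + 1 * (2 / 5 * (p - 1)) ^ 2 / 2) +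
        (1 - (3 - p)) * ((11 - 3 * p) / 2)) := by
  have hA : 0 ≤ 4 - 2 / 5 * (p - 1) := by linarith
  refine middleSector_fibre _ (volume_two_fibres (by linarith) (by linarith) (by positivity)
    (by linarith) (by measurability)
    (volume_subgraph_max (B := 4) hA zero_le_one (by linarith) (by linarith) (by ring))
    (volume_box (by linarith))) fun u q v => ?_
  simp only [middleSector, Set.mem_union, Set.mem_prod, Set.mem_Ico, Set.mem_ofPred_eq]
  grind

lemma middleSector_fibre_three_eleven_halves {p : ℝ} (h0 : 3 < p) (h1 : p < 11 / 2) :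
    volume (Prod.mk p ⁻¹' middleSector) = ENNReal.ofReal
      (1 * (1 - 2 / 5 * (p - 3) + 1 * (2 / 5 * (p - 3)) ^ 2 / 2) + (1 - 1) * 1) := by
  have hA : 0 ≤ 1 - 2 / 5 * (p - 3) := by linarith
  refine middleSector_fibre _ (volume_two_fibres zero_le_one le_rfl (by positivity)
    zero_le_one (by measurability)
    (volume_subgraph_max (B := 1) hA zero_le_one (by linarith) (by linarith) (by ring))
    (volume_box zero_le_one)) fun u q v => ?_
  simp only [middleSector, Set.mem_union, Set.mem_prod, Set.mem_Ico, Set.mem_ofPred_eq]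
  grind

lemma middleSector_fibre_plateau {p : ℝ} (h0 : 11 / 2 < p) (h1 : p < 31 / 3) :
    volume (Prod.mk p ⁻¹' middleSector) = ENNReal.ofReal
      (1 * (1 - 1 ^ 2 / 2) + (1 - 1) * 1) := by
  refine middleSector_fibre _ (volume_two_fibres zero_le_one le_rfl (by norm_num)
    zero_le_one (by measurability) (volume_truncated_triangle zero_le_one le_rfl)
    (volume_box zero_le_one)) fun u q v => ?_
  simp only [middleSector, Set.mem_union, Set.mem_prod, Set.mem_Ico, Set.mem_ofPred_eq]
  grind

lemma middleSector_fibre_tail {p : ℝ} (h0 : 31 / 3 < p) (h1 : p < 11) :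
    volume (Prod.mk p ⁻¹' middleSector) = ENNReal.ofReal
      ((11 - p) * (1 - 1 ^ 2 / 2) +
        (1 - (11 - p)) * (3 * (11 - p) / 2 - (3 * (11 - p) / 2) ^ 2 / 2)) := by
  have hm : 0 ≤ 3 * (11 - p) / 2 - (3 * (11 - p) / 2) ^ 2 / 2 := by nlinarith
  refine middleSector_fibre _ (volume_two_fibres (by linarith) (by linarith) (by norm_num)
    hm (by measurability) (volume_truncated_triangle zero_le_one le_rfl)
    (volume_truncated_triangle (by linarith) (by linarith))) fun u q v => ?_
  simp only [middleSector, Set.mem_union, Set.mem_prod, Set.mem_Ico, Set.mem_ofPred_eq]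
  grind

lemma volume_middleSector : volume middleSector = ENNReal.ofReal (49673 / 2700) := by
  have h1 := middleSector_inter_step zero_le_one 11 (-59 / 10) (-51 / 50) (-2 / 25)
    (fun p => by ring)
    (fun p hp => by
      have : 0 ≤ 11 - 2 / 5 * p := by linarith [hp.2]
      have : 0 ≤ 11 - 3 * p := by linarith [hp.2]
      have : 0 ≤ 1 - p := by linarith [hp.2]
      have : 0 ≤ 1 - (1 - p) := by linarith [hp.1]
      positivity)
    (fun p hp => middleSector_fibre_zero_one hp.1 hp.2) le_rfl middleSector_inter_zero
  have h2 := middleSector_inter_step one_le_two (112 / 25) (-14 / 25) (2 / 25) 0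
    (fun p => by ring)
    (fun p hp => by
      have : 0 ≤ 4 - 2 / 5 * (p - 1) := by linarith [hp.2]
      norm_num
      positivity)
    (fun p hp => middleSector_fibre_one_two hp.1 hp.2) (by norm_num) h1
  have h3 := middleSector_inter_step (by norm_num) (61 / 25) (117 / 50) (-7 / 10) (-2 / 25)
    (fun p => by ring)
    (fun p hp => by
      have : 0 ≤ 4 - 2 / 5 * (p - 1) := by linarith [hp.2]
      have : 0 ≤ 11 - 3 * p := by linarith [hp.2]
      have : 0 ≤ 3 - p := by linarith [hp.2]
      have : 0 ≤ 1 - (3 - p) := by linarith [hp.1]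
      positivity)
    (fun p hp => middleSector_fibre_two_three hp.1 hp.2) (by norm_num) h2
  have h4 := middleSector_inter_step (by norm_num) (73 / 25) (-22 / 25) (2 / 25) 0
    (fun p => by ring)
    (fun p hp => by
      have : 0 ≤ 1 - 2 / 5 * (p - 3) := by linarith [hp.2]
      norm_num
      positivity)
    (fun p hp => middleSector_fibre_three_eleven_halves hp.1 hp.2) (by norm_num) h3
  have h5 := middleSector_inter_step (by norm_num) (1 / 2) 0 0 0 (fun p => by ring)
    (fun p hp => by norm_num)
    (fun p hp => middleSector_fibre_plateau hp.1 hp.2) (by norm_num) h4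
  have h6 := middleSector_inter_step (by norm_num) (4807 / 4) (-2821 / 8) (69 / 2) (-9 / 8)
    (fun p => by ring)
    (fun p hp => by
      have : 0 ≤ 3 * (11 - p) / 2 - (3 * (11 - p) / 2) ^ 2 / 2 := by nlinarith [hp.1, hp.2]
      have : 0 ≤ 11 - p := by linarith [hp.2]
      have : 0 ≤ 1 - (11 - p) := by linarith [hp.1]
      have : (0 : ℝ) ≤ 1 - 1 ^ 2 / 2 := by norm_num
      positivity)
    (fun p hp => middleSector_fibre_tail hp.1 hp.2) (by norm_num) h5
  have hall : middleSector ∩ {s | s.1 < 11} = middleSector := by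
    refine Set.inter_eq_left.2 fun s hs => ?_
    simp only [middleSector, Set.mem_ofPred_eq] at hs ⊢
    grind
  rw [hall] at h6
  rw [h6]
  norm_num

lemma tupleEquiv_mulVec (M : Matrix (Fin 4) (Fin 4) ℝ) (x y z w : ℝ) :
    tupleEquiv (M.mulVec (tupleEquiv.symm (x, y, z, w))) =
      (M 0 0 * x + M 0 1 * y + M 0 2 * z + M 0 3 * w, M 1 0 * x + M 1 1 * y + M 1 2 * z + M 1 3 * w,
        M 2 0 * x + M 2 1 * y + M 2 2 * z + M 2 3 * w,
        M 3 0 * x + M 3 1 * y + M 3 2 * z + M 3 3 * w) := by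
  change (M.mulVec ![x, y, z, w] 0, M.mulVec ![x, y, z, w] 1, M.mulVec ![x, y, z, w] 2,
    M.mulVec ![x, y, z, w] 3) = _
  simp only [Matrix.mulVec, dotProduct, Fin.sum_univ_four]
  rfl

lemma volume_eq_of_affine {T R : Set (ℝ × ℝ × ℝ × ℝ)} {r d : ℝ} (hR : volume R = ENNReal.ofReal r)
    (M : Matrix (Fin 4) (Fin 4) ℝ) (b : ℝ × ℝ × ℝ × ℝ) (hd : M.det = d) (hd0 : d ≠ 0)
    (h : ∀ p, p ∈ T ↔ tupleEquiv (M.mulVec (tupleEquiv.symm p)) + b ∈ R) :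
    volume T = ENNReal.ofReal (|d⁻¹| * r) := by
  rw [ENNReal.ofReal_mul (abs_nonneg _), ← hR, ← hd, ← volume_preimage_affine M (hd ▸ hd0) b R]
  congr 1
  ext p
  exact h p

lemma volume_S_left_near : volume ((S ∩ {p | 5 * p.1 < 2 * p.2.1}) ∩ {p | p.1 < 1}) =
    ENNReal.ofReal (147 / 550 + 1 / 2) := by
  have hR : volume (outerSector (2 / 5) 3 ∩ {s | s.1 < 1}) =
      ENNReal.ofReal (147 / 550 + 1 / 2) := by
    rw [volume_outerSector_one, volume_outerSector_half (β := 4 / 5) (by norm_num) (by norm_num)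
      (by norm_num) (by norm_num) (by norm_num) (by norm_num),
      ← ENNReal.ofReal_add (by norm_num) (by norm_num)]
    norm_num
  rw [volume_eq_of_affine hR !![5 / 2, -1, 0, 0; 0, -2, 1, 0; 1, 0, 0, 0; 0, -3, 0, 1] (1, 0, 0, 0)
    (d := -1) ?_ (by norm_num) ?_]
  · norm_num
  · simp [Matrix.det_succ_row_zero, Fin.sum_univ_succ, Fin.succAbove]
  · rintro ⟨x, y, z, w⟩
    rw [tupleEquiv_mulVec]
    simp only [S, outerSector, Set.mem_inter_iff, Set.mem_ofPred_eq, Prod.mk_add_mk,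
      Matrix.of_apply, Matrix.cons_val]
    grind

lemma volume_S_left_far : volume ((S ∩ {p | 5 * p.1 < 2 * p.2.1}) \ {p | p.1 < 1}) =
    ENNReal.ofReal (147 / 550) := by
  have hR : volume (outerSector (2 / 5) 3 ∩ {s | s.1 < 1 / 2}) = ENNReal.ofReal (147 / 550) := by
    rw [volume_outerSector_half (β := 4 / 5) (by norm_num) (by norm_num)
      (by norm_num) (by norm_num) (by norm_num) (by norm_num)]
    norm_num
  rw [volume_eq_of_affine hR !![5 / 2, -1, 0, 0; 0, -2, 1, 0; 1, 0, 0, 0; 0, -3, 0, 1] (1 / 2, 0, -1, 0)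
    (d := -1) ?_ (by norm_num) ?_]
  · norm_num
  · simp [Matrix.det_succ_row_zero, Fin.sum_univ_succ, Fin.succAbove]
  · rintro ⟨x, y, z, w⟩
    rw [tupleEquiv_mulVec]
    simp only [S, outerSector, Set.mem_inter_iff, Set.mem_sdiff, Set.mem_ofPred_eq, Prod.mk_add_mk,
      Matrix.of_apply, Matrix.cons_val]
    grind

lemma volume_S_right_near : volume (((S \ {p | 5 * p.1 < 2 * p.2.1}) ∩ {p | 3 * p.2.1 < 2 * p.1}) ∩ {p | p.2.1 < 1}) =
    ENNReal.ofReal (83 / 297 + 1 / 2) := by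
  have hR : volume (outerSector (2 / 3) 5 ∩ {s | s.1 < 1}) =
      ENNReal.ofReal (83 / 297 + 1 / 2) := by
    rw [volume_outerSector_one, volume_outerSector_half (β := 4 / 3) (by norm_num) (by norm_num)
      (by norm_num) (by norm_num) (by norm_num) (by norm_num),
      ← ENNReal.ofReal_add (by norm_num) (by norm_num)]
    norm_num
  rw [volume_eq_of_affine hR !![-1, 3 / 2, 0, 0; -2, 0, 0, 1; 0, 1, 0, 0; -5, 0, 1, 0] (1, 0, 0, 0)
    (d := -1) ?_ (by norm_num) ?_]
  · norm_num
  · simp [Matrix.det_succ_row_zero, Fin.sum_univ_succ, Fin.succAbove]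
  · rintro ⟨x, y, z, w⟩
    rw [tupleEquiv_mulVec]
    simp only [S, outerSector, Set.mem_inter_iff, Set.mem_sdiff, Set.mem_ofPred_eq, Prod.mk_add_mk,
      Matrix.of_apply, Matrix.cons_val]
    grind

lemma volume_S_right_far : volume (((S \ {p | 5 * p.1 < 2 * p.2.1}) ∩ {p | 3 * p.2.1 < 2 * p.1}) \ {p | p.2.1 < 1}) =
    ENNReal.ofReal (83 / 297) := by
  have hR : volume (outerSector (2 / 3) 5 ∩ {s | s.1 < 1 / 2}) = ENNReal.ofReal (83 / 297) := by
    rw [volume_outerSector_half (β := 4 / 3) (by norm_num) (by norm_num)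
      (by norm_num) (by norm_num) (by norm_num) (by norm_num)]
    norm_num
  rw [volume_eq_of_affine hR !![-1, 3 / 2, 0, 0; -2, 0, 0, 1; 0, 1, 0, 0; -5, 0, 1, 0] (1 / 2, 0, -1, 0)
    (d := -1) ?_ (by norm_num) ?_]
  · norm_num
  · simp [Matrix.det_succ_row_zero, Fin.sum_univ_succ, Fin.succAbove]
  · rintro ⟨x, y, z, w⟩
    rw [tupleEquiv_mulVec]
    simp only [S, outerSector, Set.mem_inter_iff, Set.mem_sdiff, Set.mem_ofPred_eq, Prod.mk_add_mk,
      Matrix.of_apply, Matrix.cons_val]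
    grind

lemma volume_S_middle : volume ((S \ {p | 5 * p.1 < 2 * p.2.1}) \ {p | 3 * p.2.1 < 2 * p.1}) =
    ENNReal.ofReal (49673 / 29700) := by
  rw [volume_eq_of_affine volume_middleSector !![5, -2, 0, 0; -5, 0, 1, 0; -2, 3, 0, 0; 0, -3, 0, 1] 0
    (d := -11) ?_ (by norm_num) ?_]
  · norm_num
  · simp [Matrix.det_succ_row_zero, Fin.sum_univ_succ, Fin.succAbove]
    norm_num
  · rintro ⟨x, y, z, w⟩
    rw [tupleEquiv_mulVec]
    simp only [S, middleSector, Set.mem_sdiff, Set.mem_ofPred_eq, add_zero,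
      Matrix.of_apply, Matrix.cons_val]
    grind

/-- The volume of the Hilbert-Kunz polytope of B_R((x⁵y²),(x²y³)) is 37283/9900. -/
theorem hk_volume : volume S = 37283 / 9900 := by
  have hl : MeasurableSet {p : ℝ × ℝ × ℝ × ℝ | 5 * p.1 < 2 * p.2.1} := by measurability
  have hr : MeasurableSet {p : ℝ × ℝ × ℝ × ℝ | 3 * p.2.1 < 2 * p.1} := by measurability
  have hx : MeasurableSet {p : ℝ × ℝ × ℝ × ℝ | p.1 < 1} := by measurability
  have hy : MeasurableSet {p : ℝ × ℝ × ℝ × ℝ | p.2.1 < 1} := by measurability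
  rw [← measure_inter_add_sdiff S hl, ← measure_inter_add_sdiff (S ∩ _) hx,
    ← measure_inter_add_sdiff (S \ _) hr, ← measure_inter_add_sdiff ((S \ _) ∩ _) hy,
    volume_S_left_near, volume_S_left_far, volume_S_right_near, volume_S_right_far,
    volume_S_middle]
  iterate 4 rw [← ENNReal.ofReal_add (by norm_num) (by norm_num)]
  norm_num
  rw [ENNReal.ofReal_div_of_pos (by norm_num)]
  simp
end

section
/- Let T ⊆ ℝ⁴ be the set of points (x, y, z, w) satisfying 0 ≤ x ≤ 1, 0 ≤ y ≤ 1, 5x ≤ z < 1 + 5x, 2y ≤ z < 1 + 2y, 2x ≤ w < 1 + 2x, and 3y ≤ w < 1 + 3y. Then the 4-dimensional Lebesgue measure (volume) of T equals 1087/29700. -/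
open MeasureTheory

/-- The F-signature polytope for B_R((x⁵y²),(x²y³)): points (x,y,z,w) ∈ ℝ⁴ with
    0 ≤ x ≤ 1, 0 ≤ y ≤ 1, 5x ≤ z < 1+5x, 2y ≤ z < 1+2y, 2x ≤ w < 1+2x, 3y ≤ w < 1+3y. -/
def T : Set (ℝ × ℝ × ℝ × ℝ) :=
  {p | 0 ≤ p.1 ∧ p.1 ≤ 1 ∧ 0 ≤ p.2.1 ∧ p.2.1 ≤ 1 ∧
       5 * p.1 ≤ p.2.2.1 ∧ p.2.2.1 < 1 + 5 * p.1 ∧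
       2 * p.2.1 ≤ p.2.2.1 ∧ p.2.2.1 < 1 + 2 * p.2.1 ∧
       2 * p.1 ≤ p.2.2.2 ∧ p.2.2.2 < 1 + 2 * p.1 ∧
       3 * p.2.1 ≤ p.2.2.2 ∧ p.2.2.2 < 1 + 3 * p.2.1}

theorem setLIntegral_Ioc_eq_ofReal_sub {a b : ℝ} (hab : a ≤ b) {g : ℝ → ENNReal} {f F : ℝ → ℝ}
    (hF : ∀ x, HasDerivAt F (f x) x) (hf : Continuous f)
    (hf0 : ∀ x ∈ Set.Ioc a b, 0 ≤ f x) (hg : ∀ x ∈ Set.Ioc a b, g x = ENNReal.ofReal (f x)) :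
    ∫⁻ x in Set.Ioc a b, g x = ENNReal.ofReal (F b - F a) := by
  rw [setLIntegral_congr_fun measurableSet_Ioc hg,
    ← intervalIntegral.integral_eq_sub_of_hasDerivAt (fun x _ => hF x)
      (hf.intervalIntegrable a b), intervalIntegral.integral_of_le hab,
    ofReal_integral_eq_lintegral_ofReal]
  · exact (hf.intervalIntegrable a b).1
  · exact (ae_restrict_iff' measurableSet_Ioc).2 (Filter.Eventually.of_forall hf0)

theorem lintegral_eq_setLIntegral_Ioc {a b : ℝ} {g : ℝ → ENNReal}
    (hg : ∀ x, x < a ∨ b < x → g x = 0) : ∫⁻ x, g x = ∫⁻ x in Set.Ioc a b, g x := by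
  rw [setLIntegral_congr Ioc_ae_eq_Icc, setLIntegral_eq_of_support_subset]
  intro x hx
  by_contra h
  refine hx (hg x ?_)
  by_contra! h'
  exact h h'

theorem lintegral_eq_setLIntegral_Ioc_add {a b c : ℝ} (hab : a ≤ b) (hbc : b ≤ c)
    {g : ℝ → ENNReal} (hg : ∀ x, x < a ∨ c < x → g x = 0) :
    ∫⁻ x, g x = (∫⁻ x in Set.Ioc a b, g x) + ∫⁻ x in Set.Ioc b c, g x := by
  rw [lintegral_eq_setLIntegral_Ioc hg, ← Set.Ioc_union_Ioc_eq_Ioc hab hbc,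
    lintegral_union measurableSet_Ioc (Set.Ioc_disjoint_Ioc_of_le le_rfl)]

/-- The hat function `u ↦ max (1 - |u|) 0` truncated to the half-line `[c, ∞)`. -/
noncomputable def truncatedHat (c u : ℝ) : ENNReal :=
  if c ≤ u then ENNReal.ofReal (1 - |u|) else 0

theorem truncatedHat_eq_zero {c u : ℝ} (h : u < c ∨ 1 < u) : truncatedHat c u = 0 := by
  rw [truncatedHat]
  split_ifs with hc
  · rcases h with h | h
    · linarith
    · exact ENNReal.ofReal_of_nonpos (by linarith [le_abs_self u])
  · rfl

theorem hasDerivAt_sub_sq_half (x : ℝ) : HasDerivAt (fun u : ℝ => u - u ^ 2 / 2) (1 - x) x := by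
  refine ((hasDerivAt_id' x).sub ((hasDerivAt_pow 2 x).div_const 2)).congr_deriv ?_
  norm_num

theorem hasDerivAt_add_sq_half (x : ℝ) : HasDerivAt (fun u : ℝ => u + u ^ 2 / 2) (1 + x) x := by
  refine ((hasDerivAt_id' x).add ((hasDerivAt_pow 2 x).div_const 2)).congr_deriv ?_
  norm_num

theorem setLIntegral_truncatedHat_of_nonneg {b c : ℝ} (hb : 0 ≤ b) (hcb : c ≤ b) (hb1 : b ≤ 1) :
    ∫⁻ u in Set.Ioc b 1, truncatedHat c u = ENNReal.ofReal ((1 - b) ^ 2 / 2) := by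
  rw [setLIntegral_Ioc_eq_ofReal_sub hb1 hasDerivAt_sub_sq_half (by fun_prop)]
  · congr 1
    ring
  · rintro x ⟨-, h⟩
    linarith
  · rintro x ⟨h, -⟩
    rw [truncatedHat, if_pos (by linarith), abs_of_nonneg (by linarith)]

theorem lintegral_truncatedHat_of_nonneg {c : ℝ} (h0 : 0 ≤ c) (h1 : c ≤ 1) :
    ∫⁻ u, truncatedHat c u = ENNReal.ofReal ((1 - c) ^ 2 / 2) := by
  rw [lintegral_eq_setLIntegral_Ioc (a := c) (b := 1) fun u => truncatedHat_eq_zero,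
    setLIntegral_truncatedHat_of_nonneg h0 le_rfl h1]

theorem lintegral_truncatedHat_of_nonpos {c : ℝ} (h0 : c ≤ 0) (h1 : -1 ≤ c) :
    ∫⁻ u, truncatedHat c u = ENNReal.ofReal (1 / 2 - c - c ^ 2 / 2) := by
  rw [lintegral_eq_setLIntegral_Ioc_add h0 zero_le_one fun u => truncatedHat_eq_zero,
    setLIntegral_truncatedHat_of_nonneg le_rfl h0 zero_le_one,
    setLIntegral_Ioc_eq_ofReal_sub h0 hasDerivAt_add_sq_half (by fun_prop),
    ← ENNReal.ofReal_add (by nlinarith) (by norm_num)]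
  · congr 1
    ring
  · rintro x ⟨h, -⟩
    linarith
  · rintro x ⟨h, h'⟩
    rw [truncatedHat, if_pos h.le, abs_of_nonpos h', sub_neg_eq_add]

theorem lintegral_truncatedHat_of_one_le {c : ℝ} (h : 1 ≤ c) : ∫⁻ u, truncatedHat c u = 0 := by
  rw [lintegral_eq_setLIntegral_Ioc (a := c) (b := 1) fun u => truncatedHat_eq_zero,
    Set.Ioc_eq_empty_of_le h, setLIntegral_empty]

/-- The area of the `(z, w)`-slice of `T` in terms of `u = 5x - 2y` and `v = 2x - 3y`. -/
noncomputable def sliceArea (q : ℝ × ℝ) : ENNReal :=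
  truncatedHat (max (2 * q.2 / 3) (5 * q.2 / 2)) q.1 * ENNReal.ofReal (1 - |q.2|)

theorem measurable_sliceArea : Measurable sliceArea := by
  unfold sliceArea truncatedHat
  refine Measurable.mul (Measurable.ite (measurableSet_le ?_ ?_) ?_ ?_) ?_ <;> fun_prop

theorem lintegral_sliceArea_of_nonneg {v : ℝ} (h0 : 0 ≤ v) (h1 : v ≤ 2 / 5) :
    ∫⁻ u, sliceArea (u, v)
      = ENNReal.ofReal ((1 - 6 * v + 45 / 4 * v ^ 2 - 25 / 4 * v ^ 3) / 2) := by
  simp only [sliceArea]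
  rw [lintegral_mul_const' _ _ ENNReal.ofReal_ne_top, max_eq_right (by linarith),
    lintegral_truncatedHat_of_nonneg (by linarith) (by linarith), abs_of_nonneg h0,
    ← ENNReal.ofReal_mul (by positivity)]
  congr 1
  ring

theorem lintegral_sliceArea_of_nonpos {v : ℝ} (h0 : v ≤ 0) (h1 : -1 ≤ v) :
    ∫⁻ u, sliceArea (u, v)
      = ENNReal.ofReal (1 / 2 - v / 6 - 8 / 9 * v ^ 2 - 2 / 9 * v ^ 3) := by
  simp only [sliceArea]
  rw [lintegral_mul_const' _ _ ENNReal.ofReal_ne_top, max_eq_left (by linarith),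
    lintegral_truncatedHat_of_nonpos (by linarith) (by linarith), abs_of_nonpos h0,
    ← ENNReal.ofReal_mul (by nlinarith)]
  congr 1
  ring

theorem lintegral_sliceArea_eq_zero {v : ℝ} (h : v < -1 ∨ 2 / 5 < v) :
    ∫⁻ u, sliceArea (u, v) = 0 := by
  simp only [sliceArea]
  rw [lintegral_mul_const' _ _ ENNReal.ofReal_ne_top]
  rcases h with h | h
  · rw [ENNReal.ofReal_of_nonpos (by linarith [neg_le_abs v]), mul_zero]
  · rw [lintegral_truncatedHat_of_one_le (le_max_of_le_right (by linarith)), zero_mul]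

theorem lintegral_sliceArea : ∫⁻ q, sliceArea q = ENNReal.ofReal (1087 / 2700) := by
  rw [Measure.volume_eq_prod, lintegral_prod_symm _ measurable_sliceArea.aemeasurable,
    lintegral_eq_setLIntegral_Ioc_add (a := -1) (b := 0) (c := 2 / 5) (by norm_num) (by norm_num)
      fun v => lintegral_sliceArea_eq_zero,
    setLIntegral_Ioc_eq_ofReal_sub (by norm_num)
      (f := fun v => 1 / 2 - v / 6 - 8 / 9 * v ^ 2 - 2 / 9 * v ^ 3)
      (F := fun v => 1 / 2 * v - v ^ 2 / 12 - 8 / 27 * v ^ 3 - 1 / 18 * v ^ 4)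
      _ (by fun_prop) _ fun v hv => lintegral_sliceArea_of_nonpos hv.2 hv.1.le,
    setLIntegral_Ioc_eq_ofReal_sub (by norm_num)
      (f := fun v => (1 - 6 * v + 45 / 4 * v ^ 2 - 25 / 4 * v ^ 3) / 2)
      (F := fun v => (v - 3 * v ^ 2 + 15 / 4 * v ^ 3 - 25 / 16 * v ^ 4) / 2)
      _ (by fun_prop) _ fun v hv => lintegral_sliceArea_of_nonneg hv.1.le hv.2,
    ← ENNReal.ofReal_add (by norm_num) (by norm_num)]
  · norm_num
  · intro v
    refine HasDerivAt.congr_deriv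
      (((((hasDerivAt_id' v).sub ((hasDerivAt_pow 2 v).const_mul 3)).add
      ((hasDerivAt_pow 3 v).const_mul (15 / 4))).sub
      ((hasDerivAt_pow 4 v).const_mul (25 / 16))).div_const 2) ?_
    norm_num
    ring
  · rintro v ⟨h0, h1⟩
    have : (1 - 6 * v + 45 / 4 * v ^ 2 - 25 / 4 * v ^ 3) / 2
        = (1 - 5 * v / 2) ^ 2 * (1 - v) / 2 := by ring
    rw [this]
    have : 0 ≤ 1 - v := by linarith
    positivity
  · intro v
    refine HasDerivAt.congr_deriv
      (((((hasDerivAt_id' v).const_mul (1 / 2)).sub ((hasDerivAt_pow 2 v).div_const 12)).sub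
      ((hasDerivAt_pow 3 v).const_mul (8 / 27))).sub
      ((hasDerivAt_pow 4 v).const_mul (1 / 18))) ?_
    norm_num
    ring
  · rintro v ⟨h0, h1⟩
    have : 1 / 2 - v / 6 - 8 / 9 * v ^ 2 - 2 / 9 * v ^ 3
        = (1 / 2 - 2 / 3 * v - 2 / 9 * v ^ 2) * (1 + v) := by ring
    rw [this]
    exact mul_nonneg (by nlinarith) (by linarith)

theorem lintegral_sliceArea_comp :
    ∫⁻ p : ℝ × ℝ, sliceArea (5 * p.1 - 2 * p.2, 2 * p.1 - 3 * p.2)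
      = ENNReal.ofReal (1 / 11) * ∫⁻ q, sliceArea q := by
  set L : ℝ × ℝ →ₗ[ℝ] ℝ × ℝ :=
    Matrix.toLin (Module.Basis.finTwoProd ℝ) (Module.Basis.finTwoProd ℝ) !![5, -2; 2, -3] with hL
  have hdet : LinearMap.det L = -11 := by
    rw [hL, LinearMap.det_toLin, Matrix.det_fin_two_of]
    norm_num
  have hmap := Measure.map_linearMap_addHaar_eq_smul_addHaar (volume : Measure (ℝ × ℝ))
    (f := L) (by rw [hdet]; norm_num)
  have hmeas : Measurable L := L.continuous_of_finiteDimensional.measurable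
  have hconst : |(LinearMap.det L)⁻¹| = 1 / 11 := by
    rw [hdet, abs_of_neg] <;> norm_num
  rw [hconst] at hmap
  rw [← smul_eq_mul, ← lintegral_smul_measure, ← hmap, lintegral_map measurable_sliceArea hmeas]
  refine lintegral_congr fun p => ?_
  rw [hL, Matrix.toLin_finTwoProd_apply]
  congr 2 <;> ring

theorem measurableSet_T : MeasurableSet T := by
  simp only [T, Set.ofPred_and]
  repeat' apply MeasurableSet.inter
  all_goals first
    | exact measurableSet_le (by fun_prop) (by fun_prop)
    | exact measurableSet_lt (by fun_prop) (by fun_prop)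

theorem volume_Ico_inter_Ico_add_one (s t : ℝ) :
    volume (Set.Ico s (1 + s) ∩ Set.Ico t (1 + t)) = ENNReal.ofReal (1 - |s - t|) := by
  rw [Set.Ico_inter_Ico, Real.volume_Ico]
  congr 1
  rcases le_total s t with h | h
  · rw [sup_eq_right.2 h, inf_eq_left.2 (by linarith), abs_of_nonpos (by linarith)]
    ring
  · rw [sup_eq_left.2 h, inf_eq_right.2 (by linarith), abs_of_nonneg (by linarith)]
    ring

theorem volume_slice_T (x y : ℝ) :
    volume (Prod.mk y ⁻¹' (Prod.mk x ⁻¹' T)) = sliceArea (5 * x - 2 * y, 2 * x - 3 * y) := by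
  by_cases h : (0 ≤ x ∧ x ≤ 1) ∧ 0 ≤ y ∧ y ≤ 1
  · have : Prod.mk y ⁻¹' (Prod.mk x ⁻¹' T)
        = (Set.Ico (5 * x) (1 + 5 * x) ∩ Set.Ico (2 * y) (1 + 2 * y)) ×ˢ
          (Set.Ico (2 * x) (1 + 2 * x) ∩ Set.Ico (3 * y) (1 + 3 * y)) := by
      ext ⟨z, w⟩
      simp only [T, Set.mem_preimage, Set.mem_ofPred_eq, Set.mem_prod, Set.mem_inter_iff,
        Set.mem_Ico]
      tauto
    rw [this, Measure.volume_eq_prod, Measure.prod_prod, volume_Ico_inter_Ico_add_one,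
      volume_Ico_inter_Ico_add_one, sliceArea, truncatedHat, if_pos]
    exact max_le (by linarith) (by linarith)
  · have : Prod.mk y ⁻¹' (Prod.mk x ⁻¹' T) = ∅ := by
      ext ⟨z, w⟩
      simp only [T, Set.mem_preimage, Set.mem_ofPred_eq, Set.mem_empty_iff_false]
      tauto
    rw [this, measure_empty, eq_comm]
    simp only [sliceArea, truncatedHat, max_le_iff]
    split_ifs with hc
    · rw [mul_eq_zero, ENNReal.ofReal_eq_zero, ENNReal.ofReal_eq_zero]
      by_contra! hpos
      have hu := abs_lt.1 (sub_pos.1 hpos.1)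
      have hv := abs_lt.1 (sub_pos.1 hpos.2)
      refine h ⟨⟨?_, ?_⟩, ?_, ?_⟩ <;> linarith
    · rw [zero_mul]

/-- The volume of the F-signature polytope of B_R((x⁵y²),(x²y³)) is 1087/29700. -/
theorem fsig_volume : volume T = 1087 / 29700 := by
  have hslice (x : ℝ) : volume (Prod.mk x ⁻¹' T)
      = ∫⁻ y, sliceArea (5 * x - 2 * y, 2 * x - 3 * y) := by
    rw [Measure.volume_eq_prod,
      Measure.prod_apply (measurable_prodMk_left measurableSet_T)]
    exact lintegral_congr fun y => volume_slice_T x y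
  have hmeas : Measurable fun p : ℝ × ℝ => sliceArea (5 * p.1 - 2 * p.2, 2 * p.1 - 3 * p.2) :=
    measurable_sliceArea.comp (by fun_prop)
  rw [Measure.volume_eq_prod, Measure.prod_apply measurableSet_T, lintegral_congr hslice,
    ← lintegral_prod _ hmeas.aemeasurable, ← Measure.volume_eq_prod, lintegral_sliceArea_comp,
    lintegral_sliceArea, ← ENNReal.ofReal_mul (by norm_num)]
  norm_num [ENNReal.ofReal_div_of_pos]
end
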